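/- Suppose l satisfies Assumption 2 with I: (−∞,0) → ℝ the inverse of l′, that α_k > lim_{x→+∞} l(x) for every k ∈ {1,…,n}, and that for every k there exists a strictly negative ℱ_{k−1}-measurable Y_{k−1} with E^P[ l(I(Y_{k−1} Z_k / Z_{k−1})) ] < ∞, where Z_k = E^P[ dQ/dP | ℱ_k ]. Define (with all integrability required for the expressions to make sense) ŴV_{n−1} = E^Q[ S_n + I(λ_{n−1} Z_n/Z_{n−1}) | ℱ_{n−1} ], where λ_{n−1} is a strictly negative ℱ_{n−1}-measurable solution of E^P[ l(I(λ_{n−1} Z_n/Z_{n−1})) | ℱ_{n−1} ] = α_n a.s.; and for k ∈ {1,…,n−1}, ŴV_{k−1} = E^Q[ ŴV_k | ℱ_{k−1} ] + E^Q[ ( S_k − ŴV_k + I(λ_{k−1} Z_k/Z_{k−1}) )^+ | ℱ_{k−1} ] · 1_{{ E^P[l(ŴV_k − S_k)|ℱ_{k−1}] > α_k }}, where λ_{k−1} is a strictly negative ℱ_{k−1}-measurable solution of E^P[ l( I(λ_{k−1} Z_k/Z_{k−1}) ∨ (ŴV_k − S_k) ) | ℱ_{k−1} ] = α_k a.s.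 Then for every t ∈ {0,…,n−1}, ŴV_t is an essential infimum of { M_t : (M_s)_{s=t}^n ∈ ℳ_{TC,t} }. -/

import Mathlib

open MeasureTheory Filter
open scoped MeasureTheory

/-- A supermartingale (under measure `μ`) on the discrete time interval `{a,…,b}`. -/
def IsSupermartingaleOn {Ω : Type*} {m0 : MeasurableSpace Ω}
    (𝓕 : MeasureTheory.Filtration ℕ m0) (μ : Measure Ω)
    (M : ℕ → Ω → ℝ) (a b : ℕ) : Prop :=
  (∀ k, a ≤ k → k ≤ b → StronglyMeasurable[𝓕 k] (M k)) ∧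
  (∀ k, a ≤ k → k ≤ b → Integrable (M k) μ) ∧
  (∀ k, a ≤ k → k < b → (μ[M (k + 1)|𝓕 k]) ≤ᵐ[μ] M k)

/-- Membership in `ℳ_{TC,k}`. -/
def MemTC {Ω : Type*} {m0 : MeasurableSpace Ω}
    (𝓕 : MeasureTheory.Filtration ℕ m0) (P Q : Measure Ω)
    (S : ℕ → Ω → ℝ) (l : ℝ → ℝ) (α : ℕ → ℝ) (k n : ℕ)
    (M : ℕ → Ω → ℝ) : Prop :=
  IsSupermartingaleOn 𝓕 Q M k n ∧
  ∀ t, k + 1 ≤ t → t ≤ n →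
    Integrable (fun ω => l (M t ω - S t ω)) P ∧
    (P[fun ω => l (M t ω - S t ω)|𝓕 (t - 1)]) ≤ᵐ[P] fun _ => α t

/-- `W` is an essential infimum (under `μ`) of the family `A` of random variables. -/
def IsEssInf {Ω : Type*} {m0 : MeasurableSpace Ω} (μ : Measure Ω)
    (A : Set (Ω → ℝ)) (W : Ω → ℝ) : Prop :=
  (∀ M ∈ A, W ≤ᵐ[μ] M) ∧ ∀ W' : Ω → ℝ, (∀ M ∈ A, W' ≤ᵐ[μ] M) → W' ≤ᵐ[μ] W


/-- A differentiable convex function lies above its tangent lines. -/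
lemma ConvexOn.mul_sub_le_sub_of_hasDerivAt {f : ℝ → ℝ} (hf : ConvexOn ℝ Set.univ f)
    {f' x : ℝ} (hx : HasDerivAt f f' x) (y : ℝ) : f' * (y - x) ≤ f y - f x := by
  rcases lt_trichotomy x y with h | rfl | h
  · have := hf.le_slope_of_hasDerivAt (Set.mem_univ x) (Set.mem_univ y) h hx
    rwa [slope_def_field, le_div_iff₀ (sub_pos.2 h)] at this
  · simp
  · have := hf.slope_le_of_hasDerivAt (Set.mem_univ y) (Set.mem_univ x) h hx
    rw [slope_def_field, div_le_iff₀ (sub_pos.2 h)] at this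
    linarith

lemma ConvexOn.monotone_of_hasDerivAt {f f' : ℝ → ℝ} (hf : ConvexOn ℝ Set.univ f)
    (hf' : ∀ x, HasDerivAt f (f' x) x) : Monotone f' := by
  intro x y hxy
  rcases hxy.eq_or_lt with rfl | h
  · exact le_rfl
  · exact (hf.le_slope_of_hasDerivAt (Set.mem_univ x) (Set.mem_univ y) h (hf' x)).trans
      (hf.slope_le_of_hasDerivAt (Set.mem_univ x) (Set.mem_univ y) h (hf' y))

/-- The subgradient inequality at the floored optimizer `max (I y) v`. -/
lemma ConvexOn.mul_sub_max_le {f f' I : ℝ → ℝ} (hf : ConvexOn ℝ Set.univ f)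
    (hf' : ∀ x, HasDerivAt f (f' x) x) {y v x : ℝ} (hI : f' (I y) = y) (hvx : v ≤ x) :
    y * (x - max (I y) v) ≤ f x - f (max (I y) v) := by
  refine le_trans ?_ (hf.mul_sub_le_sub_of_hasDerivAt (hf' _) x)
  rcases le_total v (I y) with h | h
  · rw [max_eq_left h, hI]
  · rw [max_eq_right h]
    have := hf.monotone_of_hasDerivAt hf' h
    rw [hI] at this
    exact mul_le_mul_of_nonneg_right this (sub_nonneg.2 hvx)

/-- The inverse of a monotone derivative is measurable on the negative half-line. -/
lemma measurable_indicator_Iio_of_leftInverse {f' I : ℝ → ℝ} (hmono : Monotone f')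
    (hI₁ : ∀ y : ℝ, y < 0 → f' (I y) = y) (hI₂ : ∀ x : ℝ, I (f' x) = x) :
    Measurable ((Set.Iio (0 : ℝ)).indicator I) := by
  refine measurable_of_Iio fun a => ?_
  have : (Set.Iio (0 : ℝ)).indicator I ⁻¹' Set.Iio a
      = (Set.Iio 0 ∩ Set.Iio (f' a)) ∪ (Set.Ici 0 ∩ {_y | 0 < a}) := by
    ext y
    rcases lt_or_ge y 0 with hy | hy
    · have : I y < a ↔ y < f' a := by
        constructor
        · intro h
          refine lt_of_le_of_ne ((hI₁ y hy).symm.le.trans (hmono h.le)) ?_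
          intro he
          rw [he, hI₂] at h
          exact lt_irrefl _ h
        · intro h
          by_contra! hc
          have := hmono hc
          rw [hI₁ y hy] at this
          exact absurd h this.not_gt
      simp [hy, this]
    · simp [hy]
  rw [this]
  exact (measurableSet_Iio.inter measurableSet_Iio).union
    (measurableSet_Ici.inter (MeasurableSet.const _))

section CondExp

variable {Ω : Type*} {m m' m0 : MeasurableSpace Ω} {P Q : Measure Ω}

lemma condExp_nonneg_of_neg_mul_le [IsFiniteMeasure P] (hm : m ≤ m0) {G D c : Ω → ℝ}
    (hG : Integrable G P) (hD : Integrable D P) (hc : StronglyMeasurable[m] c)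
    (hc0 : ∀ᵐ ω ∂P, 0 ≤ c ω) (hD0 : P[D|m] ≤ᵐ[P] 0)
    (hle : ∀ᵐ ω ∂P, -(c ω * D ω) ≤ G ω) : 0 ≤ᵐ[P] P[G|m] := by
  have key : ∀ N : ℕ, ∀ᵐ ω ∂P, |c ω| ≤ N → 0 ≤ (P[G|m]) ω := by
    intro N
    let s : Set Ω := {ω | |c ω| ≤ N}
    have hs : MeasurableSet[m] s := hc.norm.measurable measurableSet_Iic
    have hsc : StronglyMeasurable[m] (s.indicator c) := hc.indicator hs
    have hbd : ∀ ω, ‖s.indicator c ω‖ ≤ N := by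
      intro ω
      by_cases h : ω ∈ s
      · rw [Set.indicator_of_mem h]
        exact h
      · simp [h]
    have hint : Integrable (s.indicator c * D) P :=
      hD.bdd_mul (hsc.mono hm).aestronglyMeasurable (ae_of_all _ hbd)
    have h1 := condExp_mul_of_stronglyMeasurable_left hsc hint hD
    have h2 : P[-(s.indicator c * D)|m] ≤ᵐ[P] P[s.indicator G|m] := by
      refine condExp_mono hint.neg (hG.indicator (hm _ hs)) ?_
      filter_upwards [hle] with ω hω
      by_cases h : ω ∈ s <;> simp [h, hω]
    filter_upwards [h1, h2, condExp_neg (s.indicator c * D) m, condExp_indicator hG hs, hc0, hD0]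
      with ω h1 h2 h3 h4 h5 h6 hN
    have hω : ω ∈ s := hN
    rw [h3, h4, Pi.neg_apply, h1] at h2
    simp only [Pi.mul_apply, Set.indicator_of_mem hω, Pi.zero_apply] at h2 h6
    nlinarith [mul_nonneg h5 (neg_nonneg.2 h6)]
  filter_upwards [ae_all_iff.2 key] with ω hω
  obtain ⟨N, hN⟩ := exists_nat_ge |c ω|
  exact hω N hN

lemma integrable_mul_of_withDensity_ofReal {Z H : Ω → ℝ} (hZmeas : Measurable Z)
    (hZpos : ∀ᵐ ω ∂P, 0 < Z ω) (hZ : P.withDensity (fun ω => ENNReal.ofReal (Z ω)) = Q)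
    (hH : Integrable H Q) : Integrable (Z * H) P := by
  rw [← hZ, integrable_withDensity_iff_integrable_smul' hZmeas.ennreal_ofReal (by simp)] at hH
  refine hH.congr ?_
  filter_upwards [hZpos] with ω h
  simp [ENNReal.toReal_ofReal h.le]

lemma setIntegral_withDensity_ofReal {Z H : Ω → ℝ} (hZmeas : Measurable Z)
    (hZpos : ∀ᵐ ω ∂P, 0 < Z ω) (hZ : P.withDensity (fun ω => ENNReal.ofReal (Z ω)) = Q)
    {s : Set Ω} (hs : MeasurableSet s) : ∫ ω in s, H ω ∂Q = ∫ ω in s, (Z * H) ω ∂P := by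
  rw [← hZ, setIntegral_withDensity_eq_setIntegral_toReal_smul hZmeas.ennreal_ofReal (by simp) _ hs]
  refine integral_congr_ae (ae_restrict_of_ae ?_)
  filter_upwards [hZpos] with ω h
  simp [ENNReal.toReal_ofReal h.le]

/-- Nonnegativity of conditional expectations transfers under a change of measure. -/
lemma condExp_nonneg_of_condExp_density_mul_nonneg [IsFiniteMeasure P] [IsFiniteMeasure Q]
    (hm : m ≤ m0) {Z H : Ω → ℝ} (hZmeas : Measurable Z)
    (hZpos : ∀ᵐ ω ∂P, 0 < Z ω) (hZ : P.withDensity (fun ω => ENNReal.ofReal (Z ω)) = Q)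
    (hH : Integrable H Q) (h0 : 0 ≤ᵐ[P] P[Z * H|m]) : 0 ≤ᵐ[Q] Q[H|m] := by
  refine ae_le_of_ae_le_trim (hm := hm) ?_
  refine ae_nonneg_of_forall_setIntegral_nonneg
    (integrable_condExp.trim hm stronglyMeasurable_condExp) fun s hs _ => ?_
  rw [← setIntegral_trim hm stronglyMeasurable_condExp hs, setIntegral_condExp hm hH hs,
    setIntegral_withDensity_ofReal hZmeas hZpos hZ (hm _ hs),
    ← setIntegral_condExp hm (integrable_mul_of_withDensity_ofReal hZmeas hZpos hZ hH) hs]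
  exact setIntegral_nonneg_of_ae h0

/-- The conditional Lagrangian argument: if `lam < 0` is known at the earlier date and
`lam * (Z' / Z₀) * H` is dominated by a `D` with nonpositive conditional `P`-expectation, then `H`
has nonnegative conditional `Q`-expectation. -/
lemma condExp_nonneg_of_multiplier [IsFiniteMeasure P] [IsFiniteMeasure Q]
    (hPQ : P ≪ Q) (hmm' : m ≤ m') (hm' : m' ≤ m0)
    {Z H D lam Z₀ Z' : Ω → ℝ} (hZmeas : Measurable Z)
    (hZpos : ∀ᵐ ω ∂P, 0 < Z ω) (hZint : Integrable Z P)
    (hZ : P.withDensity (fun ω => ENNReal.ofReal (Z ω)) = Q)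
    (hZ' : Z' =ᵐ[P] P[Z|m']) (hZ₀meas : StronglyMeasurable[m] Z₀) (hZ₀pos : ∀ᵐ ω ∂P, 0 < Z₀ ω)
    (hlam : StronglyMeasurable[m] lam) (hlamneg : ∀ᵐ ω ∂P, lam ω < 0)
    (hH : Integrable H Q) (hHmeas : AEStronglyMeasurable[m'] H P)
    (hD : Integrable D P) (hD0 : P[D|m] ≤ᵐ[P] 0)
    (hle : ∀ᵐ ω ∂P, lam ω * Z' ω / Z₀ ω * H ω ≤ D ω) : 0 ≤ᵐ[P] Q[H|m] := by
  refine hPQ.ae_le ?_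
  have hZH := integrable_mul_of_withDensity_ofReal hZmeas hZpos hZ hH
  refine condExp_nonneg_of_condExp_density_mul_nonneg (hmm'.trans hm') hZmeas hZpos hZ hH ?_
  refine EventuallyLE.trans_eq ?_ (condExp_condExp_of_le hmm' hm')
  refine condExp_nonneg_of_neg_mul_le (hmm'.trans hm') (c := fun ω => Z₀ ω / (-lam ω))
    integrable_condExp hD
    (hZ₀meas.measurable.div hlam.measurable.neg).stronglyMeasurable ?_ hD0 ?_
  · filter_upwards [hZ₀pos, hlamneg] with ω h1 h2
    exact div_nonneg h1.le (by linarith)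
  · filter_upwards [condExp_mul_of_aestronglyMeasurable_right hHmeas hZH hZint, hZ', hZ₀pos,
      hlamneg, hle] with ω h1 h2 h3 h4 h5
    rw [h1, Pi.mul_apply, ← h2]
    have h6 : 0 < Z₀ ω / (-lam ω) := div_pos h3 (by linarith)
    have h7 := mul_le_mul_of_nonneg_left h5 h6.le
    have h8 : Z₀ ω / (-lam ω) * (lam ω * Z' ω / Z₀ ω * H ω) = -(Z' ω * H ω) := by
      have := h4.ne
      have := h3.ne'
      field_simp
    linarith

end CondExp

/-- A process satisfying the constraints almost surely has an adapted modification in `MemTC`. -/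
lemma exists_memTC_of_ae {Ω : Type*} {m0 : MeasurableSpace Ω} {P Q : Measure Ω}
    (hQP : Q ≪ P) {𝓕 : Filtration ℕ m0} {S : ℕ → Ω → ℝ} {l : ℝ → ℝ} {α : ℕ → ℝ}
    {t n : ℕ} (htn : t ≤ n) {N : ℕ → Ω → ℝ}
    (hmeas : ∀ k, t ≤ k → k ≤ n → AEStronglyMeasurable[𝓕 k] (N k) P)
    (hint : ∀ k, t ≤ k → k ≤ n → Integrable (N k) Q)
    (hsup : ∀ k, t ≤ k → k < n → Q[N (k + 1)|𝓕 k] ≤ᵐ[P] N k)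
    (hl : ∀ k, t + 1 ≤ k → k ≤ n → Integrable (fun ω => l (N k ω - S k ω)) P ∧
      P[fun ω => l (N k ω - S k ω)|𝓕 (k - 1)] ≤ᵐ[P] fun _ => α k) :
    ∃ M : ℕ → Ω → ℝ, MemTC 𝓕 P Q S l α t n M ∧ M t =ᵐ[P] N t := by
  have hex : ∀ k, ∃ M : Ω → ℝ, t ≤ k → k ≤ n → StronglyMeasurable[𝓕 k] M ∧ M =ᵐ[P] N k := by
    intro k
    by_cases h : t ≤ k ∧ k ≤ n
    · obtain ⟨M, hM, hMN⟩ := hmeas k h.1 h.2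
      exact ⟨M, fun _ _ => ⟨hM, hMN.symm⟩⟩
    · exact ⟨N k, fun h1 h2 => absurd ⟨h1, h2⟩ h⟩
  choose M hM using hex
  refine ⟨M, ⟨⟨fun k h1 h2 => (hM k h1 h2).1, fun k h1 h2 => ?_, fun k h1 h2 => ?_⟩,
    fun k h1 h2 => ?_⟩, (hM t le_rfl htn).2⟩
  · exact (hint k h1 h2).congr (hQP.ae_eq (hM k h1 h2).2).symm
  · exact (condExp_congr_ae (hQP.ae_eq (hM (k + 1) (by omega) h2).2)).trans_le
      (hQP.ae_le ((hsup k h1 h2).trans_eq (hM k h1 h2.le).2.symm))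
  · have he : (fun ω => l (M k ω - S k ω)) =ᵐ[P] fun ω => l (N k ω - S k ω) := by
      filter_upwards [(hM k (by omega) h2).2] with ω h
      rw [h]
    exact ⟨(hl k h1 h2).1.congr he.symm, (condExp_congr_ae he).trans_le (hl k h1 h2).2⟩

/-- Proposition 3.6 (explicit value functions under the time-consistent
constraint, Assumption 2): the process `V̂` defined by the explicit backward
recursion involving `I = (l')⁻¹` and the multipliers `λ_k` is, at every date
`t ∈ {0,…,n-1}`, an essential infimum of `{ M_t : (M_s)_{s=t}^n ∈ ℳ_{TC,t} }`. -/
theorem stmt_9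
    {Ω : Type*} {m0 : MeasurableSpace Ω} (P Q : Measure Ω)
    [IsProbabilityMeasure P] [IsProbabilityMeasure Q]
    (hPQ : P ≪ Q) (hQP : Q ≪ P)
    (𝓕 : Filtration ℕ m0) (n : ℕ) (hn : 1 ≤ n)
    (htriv : ∀ s : Set Ω, MeasurableSet[𝓕 0] s → P s = 0 ∨ P s = 1)
    (Z : Ω → ℝ) (hZmeas : Measurable Z) (hZpos : ∀ᵐ ω ∂P, 0 < Z ω)
    (hZ : P.withDensity (fun ω => ENNReal.ofReal (Z ω)) = Q)
    (Zc : ℕ → Ω → ℝ) (hZc : ∀ k, Zc k =ᵐ[P] P[Z|𝓕 k])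
    (hZcmeas : ∀ k, StronglyMeasurable[𝓕 k] (Zc k))
    (hZcpos : ∀ k, ∀ᵐ ω ∂P, 0 < Zc k ω)
    (S : ℕ → Ω → ℝ) (hS : Adapted 𝓕 S) (hSint : ∀ t, Integrable (S t) Q)
    (α : ℕ → ℝ)
    (l l' : ℝ → ℝ)
    (hconv : StrictConvexOn ℝ Set.univ l) (hdec : StrictAnti l)
    (hbdd : ∃ c : ℝ, ∀ x : ℝ, c ≤ l x)
    (hderiv : ∀ x, HasDerivAt l (l' x) x) (hcont : Continuous l')
    (hInada₁ : Tendsto l' atBot atBot) (hInada₂ : Tendsto l' atTop (nhds 0))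
    (I : ℝ → ℝ) (hI₁ : ∀ y : ℝ, y < 0 → l' (I y) = y) (hI₂ : ∀ x : ℝ, I (l' x) = x)
    (L : ℝ) (hlim : Tendsto l atTop (nhds L))
    (hα : ∀ k, 1 ≤ k → k ≤ n → L < α k)
    (hY : ∀ k, 1 ≤ k → k ≤ n → ∃ Y : Ω → ℝ,
      StronglyMeasurable[𝓕 (k - 1)] Y ∧ (∀ ω, Y ω < 0) ∧
      Integrable (fun ω => l (I (Y ω * Zc k ω / Zc (k - 1) ω))) P)
    (lam : ℕ → Ω → ℝ)
    (hlammeas : ∀ k, k ≤ n - 1 → StronglyMeasurable[𝓕 k] (lam k))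
    (hlamneg : ∀ k, k ≤ n - 1 → ∀ᵐ ω ∂P, lam k ω < 0)
    (hlamlast :
      (P[fun ω => l (I (lam (n - 1) ω * Zc n ω / Zc (n - 1) ω))|𝓕 (n - 1)])
        =ᵐ[P] fun _ => α n)
    (Vh : ℕ → Ω → ℝ)
    (hlamrec : ∀ k, 1 ≤ k → k ≤ n - 1 →
      (P[fun ω => l (max (I (lam (k - 1) ω * Zc k ω / Zc (k - 1) ω))
          (Vh k ω - S k ω))|𝓕 (k - 1)]) =ᵐ[P] fun _ => α k)
    (hVlast : Vh (n - 1)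
      =ᵐ[P] Q[fun ω => S n ω + I (lam (n - 1) ω * Zc n ω / Zc (n - 1) ω)|𝓕 (n - 1)])
    (hVrec : ∀ k, 1 ≤ k → k ≤ n - 1 →
      Vh (k - 1) =ᵐ[P] fun ω =>
        (Q[Vh k|𝓕 (k - 1)]) ω +
        (if α k < (P[fun ω' => l (Vh k ω' - S k ω')|𝓕 (k - 1)]) ω then
          (Q[fun ω' => max (S k ω' - Vh k ω'
              + I (lam (k - 1) ω' * Zc k ω' / Zc (k - 1) ω')) 0|𝓕 (k - 1)]) ω
        else 0))
    (hint₁ : Integrable (fun ω => S n ω + I (lam (n - 1) ω * Zc n ω / Zc (n - 1) ω)) Q)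
    (hint₂ : Integrable (fun ω => l (I (lam (n - 1) ω * Zc n ω / Zc (n - 1) ω))) P)
    (hint₃ : ∀ k, k ≤ n - 1 → Integrable (Vh k) Q)
    (hint₄ : ∀ k, 1 ≤ k → k ≤ n - 1 → Integrable (fun ω => l (Vh k ω - S k ω)) P)
    (hint₅ : ∀ k, 1 ≤ k → k ≤ n - 1 →
      Integrable (fun ω => max (S k ω - Vh k ω
        + I (lam (k - 1) ω * Zc k ω / Zc (k - 1) ω)) 0) Q)
    (hint₆ : ∀ k, 1 ≤ k → k ≤ n - 1 →
      Integrable (fun ω => l (max (I (lam (k - 1) ω * Zc k ω / Zc (k - 1) ω))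
        (Vh k ω - S k ω))) P) :
    ∀ t, t ≤ n - 1 →
      IsEssInf P {f : Ω → ℝ | ∃ M : ℕ → Ω → ℝ,
        MemTC 𝓕 P Q S l α t n M ∧ f = M t} (Vh t) := by
  have hZint : Integrable Z P := by
    refine (integrable_mul_of_withDensity_ofReal hZmeas hZpos hZ (integrable_const (1 : ℝ))).congr
      (ae_of_all _ fun ω => ?_)
    simp
  have hconv' := hconv.convexOn
  have hmono := hconv'.monotone_of_hasDerivAt hderiv
  let J : ℕ → Ω → ℝ := fun k ω => I (lam (k - 1) ω * Zc k ω / Zc (k - 1) ω)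
  have hyneg : ∀ k, 1 ≤ k → k ≤ n → ∀ᵐ ω ∂P, lam (k - 1) ω * Zc k ω / Zc (k - 1) ω < 0 := by
    intro k h1 h2
    filter_upwards [hlamneg (k - 1) (by omega), hZcpos k, hZcpos (k - 1)] with ω a b c
    exact div_neg_of_neg_of_pos (mul_neg_of_neg_of_pos a b) c
  have hSmeas : ∀ k, AEStronglyMeasurable[𝓕 k] (S k) P := fun k =>
    (hS k).stronglyMeasurable.aestronglyMeasurable
  have hJmeas : ∀ k, 1 ≤ k → k ≤ n → AEStronglyMeasurable[𝓕 k] (J k) P := by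
    intro k h1 h2
    have hle : 𝓕 (k - 1) ≤ 𝓕 k := 𝓕.mono (by omega)
    refine ⟨fun ω => (Set.Iio (0 : ℝ)).indicator I (lam (k - 1) ω * Zc k ω / Zc (k - 1) ω), ?_, ?_⟩
    · exact ((measurable_indicator_Iio_of_leftInverse hmono hI₁ hI₂).comp
        ((((hlammeas (k - 1) (by omega)).mono hle).measurable.mul (hZcmeas k).measurable).div
          ((hZcmeas (k - 1)).mono hle).measurable)).stronglyMeasurable
    · filter_upwards [hyneg k h1 h2] with ω h
      exact (Set.indicator_of_mem (s := Set.Iio (0 : ℝ)) h I).symm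
  have hVmeas : ∀ k, k ≤ n - 1 → AEStronglyMeasurable[𝓕 k] (Vh k) P := by
    intro k hk
    rcases hk.eq_or_lt with rfl | h
    · exact ⟨_, stronglyMeasurable_condExp, hVlast⟩
    · refine ⟨_, ?_, hVrec (k + 1) (by omega) (by omega)⟩
      refine stronglyMeasurable_condExp.add (StronglyMeasurable.ite ?_ stronglyMeasurable_condExp
        stronglyMeasurable_const)
      exact stronglyMeasurable_condExp.measurable measurableSet_Ioi
  have hpmeas : ∀ k, 1 ≤ k → k ≤ n - 1 →
      AEStronglyMeasurable[𝓕 k] (fun ω => max (S k ω - Vh k ω + J k ω) 0) P := by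
    intro k h1 h2
    have h := ((hSmeas k).sub (hVmeas k h2)).add (hJmeas k h1 (by omega))
    exact (continuous_id.max continuous_const).comp_aestronglyMeasurable h
  -- comparison of any admissible position `X` with the optimizer `U` over one period
  have hcmp : ∀ k, 1 ≤ k → k ≤ n → ∀ X U : Ω → ℝ, AEStronglyMeasurable[𝓕 k] X P →
      AEStronglyMeasurable[𝓕 k] U P → Integrable X Q → Integrable U Q →
      Integrable (fun ω => l (X ω - S k ω)) P → Integrable (fun ω => l (U ω - S k ω)) P →
      P[fun ω => l (X ω - S k ω)|𝓕 (k - 1)] ≤ᵐ[P] (fun _ => α k) →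
      P[fun ω => l (U ω - S k ω)|𝓕 (k - 1)] =ᵐ[P] (fun _ => α k) →
      (∀ᵐ ω ∂P, lam (k - 1) ω * Zc k ω / Zc (k - 1) ω * (X ω - U ω)
        ≤ l (X ω - S k ω) - l (U ω - S k ω)) →
      Q[U|𝓕 (k - 1)] ≤ᵐ[P] Q[X|𝓕 (k - 1)] := by
    intro k h1 h2 X U hXm hUm hX hU hlX hlU hαX hαU hle
    have hD0 : P[(fun ω => l (X ω - S k ω)) - fun ω => l (U ω - S k ω)|𝓕 (k - 1)] ≤ᵐ[P] 0 := by
      filter_upwards [condExp_sub hlX hlU (𝓕 (k - 1)), hαX, hαU] with ω a b c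
      rw [a, Pi.sub_apply, c]
      exact sub_nonpos.2 b
    have h := condExp_nonneg_of_multiplier (H := X - U) hPQ (𝓕.mono (by omega)) (𝓕.le k) hZmeas
      hZpos hZint hZ (hZc k) (hZcmeas (k - 1)) (hZcpos (k - 1)) (hlammeas (k - 1) (by omega))
      (hlamneg (k - 1) (by omega)) (hX.sub hU) (hXm.sub hUm) (hlX.sub hlU) hD0 hle
    filter_upwards [h, hPQ.ae_eq (condExp_sub hX hU (𝓕 (k - 1)))] with ω a b
    rw [b] at a
    exact sub_nonneg.1 a
  have hlower : ∀ t M, MemTC 𝓕 P Q S l α t n M → ∀ d s, s + d = n - 1 → t ≤ s →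
      Vh s ≤ᵐ[P] M s := by
    rintro t M ⟨⟨hMm, hMi, hMs⟩, hMl⟩ d
    induction d with
    | zero =>
      intro s hs hts
      obtain rfl : s = n - 1 := by omega
      have hsup := hPQ.ae_le (hMs (n - 1) hts (by omega))
      rw [Nat.sub_add_cancel hn] at hsup
      refine hVlast.trans_le (EventuallyLE.trans ?_ hsup)
      have hl := hMl n (by omega) le_rfl
      refine hcmp n hn le_rfl (M n) _ (hMm n (by omega) le_rfl).aestronglyMeasurable
        ((hSmeas n).add (hJmeas n hn le_rfl)) (hMi n (by omega) le_rfl) hint₁ hl.1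
        (by simpa using hint₂) hl.2 (by simpa using hlamlast) ?_
      filter_upwards [hyneg n hn le_rfl] with ω hy
      have := hconv'.mul_sub_le_sub_of_hasDerivAt
        (hderiv (I (lam (n - 1) ω * Zc n ω / Zc (n - 1) ω))) (M n ω - S n ω)
      rw [hI₁ _ hy] at this
      rwa [add_sub_cancel_left, ← sub_sub]
    | succ d ih =>
      intro s hs hts
      have hVM := ih (s + 1) (by omega) (by omega)
      have hsup := hPQ.ae_le (hMs s hts (by omega))
      have hl := hMl (s + 1) (by omega) (by omega)
      have hVi := hint₃ (s + 1) (by omega)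
      have hpi := hint₅ (s + 1) (by omega) (by omega)
      have hlr := hlamrec (s + 1) (by omega) (by omega)
      have hli := hint₆ (s + 1) (by omega) (by omega)
      have hmax : ∀ ω, Vh (s + 1) ω + max (S (s + 1) ω - Vh (s + 1) ω + J (s + 1) ω) 0
          - S (s + 1) ω = max (J (s + 1) ω) (Vh (s + 1) ω - S (s + 1) ω) := by
        intro ω
        rw [add_sub_right_comm, ← max_add_add_left]
        congr 1 <;> ring
      have hU := hcmp (s + 1) (by omega) (by omega) (M (s + 1))
        (Vh (s + 1) + fun ω => max (S (s + 1) ω - Vh (s + 1) ω + J (s + 1) ω) 0)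
        (hMm (s + 1) (by omega) (by omega)).aestronglyMeasurable
        ((hVmeas _ (by omega)).add
          (hpmeas _ (by omega) (by omega))) (hMi (s + 1) (by omega) (by omega)) (hVi.add hpi) hl.1
        (by simpa only [Pi.add_apply, hmax] using hli) hl.2
        (by simpa only [Pi.add_apply, hmax] using hlr) (by
          filter_upwards [hyneg (s + 1) (by omega) (by omega), hVM] with ω hy hv
          have := hconv'.mul_sub_max_le (I := I) hderiv (hI₁ _ hy)
            (sub_le_sub_right hv (S (s + 1) ω))
          have h3 := hmax ω
          simp only [Pi.add_apply, h3]
          have h4 : M (s + 1) ω - (Vh (s + 1) ω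
              + max (S (s + 1) ω - Vh (s + 1) ω + J (s + 1) ω) 0)
              = M (s + 1) ω - S (s + 1) ω
                - max (J (s + 1) ω) (Vh (s + 1) ω - S (s + 1) ω) := by linarith
          rw [h4]
          exact this)
      have hVM' := hPQ.ae_le (condExp_mono (m := 𝓕 s) hVi (hMi (s + 1) (by omega) (by omega))
        (hQP.ae_le hVM))
      filter_upwards [hVrec (s + 1) (by omega) (by omega), hU, hVM', hsup,
        hPQ.ae_eq (condExp_add hVi hpi (𝓕 s))] with ω a b c e f
      refine le_trans ?_ e
      simp only [Nat.add_sub_cancel] at a b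
      rw [a]
      split_ifs
      · exact f.symm.le.trans b
      · rwa [add_zero]
  intro t ht
  refine ⟨?_, ?_⟩
  · rintro f ⟨M, hM, rfl⟩
    exact hlower t M hM (n - 1 - t) t (by omega) le_rfl
  let A : ℕ → Set Ω := fun k =>
    {ω | α k < (P[fun ω' => l (Vh k ω' - S k ω')|𝓕 (k - 1)]) ω}
  have hA : ∀ k, MeasurableSet[𝓕 (k - 1)] (A k) := fun k =>
    stronglyMeasurable_condExp.measurable measurableSet_Ioi
  -- the cheapest admissible continuation of the value process
  let R : ℕ → Ω → ℝ := fun k =>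
    Vh k + (A k).indicator fun ω => max (S k ω - Vh k ω + J k ω) 0
  have hRint : ∀ k, 1 ≤ k → k ≤ n - 1 → Integrable (R k) Q := fun k h1 h2 =>
    (hint₃ k h2).add ((hint₅ k h1 h2).indicator (𝓕.le _ _ (hA k)))
  have hRmeas : ∀ k, 1 ≤ k → k ≤ n - 1 → AEStronglyMeasurable[𝓕 k] (R k) P := by
    intro k h1 h2
    obtain ⟨g, hg, hge⟩ := hpmeas k h1 h2
    exact (hVmeas k h2).add
      ⟨_, hg.indicator (𝓕.mono (Nat.sub_le k 1) _ (hA k)), hge.indicator⟩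
  have hRcond : ∀ k, 1 ≤ k → k ≤ n - 1 → Q[R k|𝓕 (k - 1)] =ᵐ[P] Vh (k - 1) := by
    intro k h1 h2
    filter_upwards [hPQ.ae_eq (condExp_add (hint₃ k h2)
      ((hint₅ k h1 h2).indicator (𝓕.le _ _ (hA k))) (𝓕 (k - 1))), hVrec k h1 h2,
      hPQ.ae_eq (condExp_indicator (hint₅ k h1 h2) (hA k))] with ω a b c
    refine a.trans ?_
    rw [b, Pi.add_apply, c]
    rfl
  have hRl : ∀ k, 1 ≤ k → k ≤ n - 1 → Integrable (fun ω => l (R k ω - S k ω)) P ∧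
      P[fun ω => l (R k ω - S k ω)|𝓕 (k - 1)] ≤ᵐ[P] fun _ => α k := by
    intro k h1 h2
    have he : (fun ω => l (R k ω - S k ω))
        = (A k).indicator (fun ω => l (max (J k ω) (Vh k ω - S k ω)))
          + (A k)ᶜ.indicator (fun ω => l (Vh k ω - S k ω)) := by
      ext ω
      by_cases h : ω ∈ A k
      · simp only [R, Pi.add_apply, Set.indicator_of_mem h, Set.indicator_of_notMem
          (Set.notMem_compl_iff.2 h), add_zero]
        rw [add_sub_right_comm, ← max_add_add_left]
        congr 2 <;> ring
      · simp [R, h]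
    have hi1 := (hint₆ k h1 h2).indicator (𝓕.le _ _ (hA k))
    have hi2 := (hint₄ k h1 h2).indicator (𝓕.le _ _ (hA k).compl)
    rw [he]
    refine ⟨hi1.add hi2, ?_⟩
    filter_upwards [condExp_add hi1 hi2 (𝓕 (k - 1)), condExp_indicator (hint₆ k h1 h2) (hA k),
      condExp_indicator (hint₄ k h1 h2) (hA k).compl, hlamrec k h1 h2] with ω a b c e
    refine a.trans_le ?_
    rw [Pi.add_apply, b, c]
    by_cases h : ω ∈ A k
    · simp [h, e]
    · simpa [h] using not_lt.1 h
  let N : ℕ → Ω → ℝ := fun k =>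
    if k = t then Vh t else if k = n then fun ω => S n ω + J n ω else R k
  have hNt : N t = Vh t := if_pos rfl
  have hNn : N n = fun ω => S n ω + J n ω := by
    simp [N, show n ≠ t by omega]
  have hNR : ∀ k, k ≠ t → k ≠ n → N k = R k := fun k h1 h2 => by simp [N, h1, h2]
  have hNge : ∀ k, k < n → ∀ ω, Vh k ω ≤ N k ω := by
    intro k hk ω
    by_cases h : k = t
    · rw [h, hNt]
    · rw [hNR k h hk.ne]
      exact le_add_of_nonneg_right (Set.indicator_nonneg (fun _ _ => le_max_right _ _) ω)
  obtain ⟨M, hM, hMt⟩ := exists_memTC_of_ae (𝓕 := 𝓕) (S := S) (l := l) (α := α) (t := t) (n := n)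
    (N := N) hQP (by omega)
    (by
      intro k h1 h2
      by_cases hk : k = t
      · rw [hk, hNt]
        exact hVmeas t ht
      by_cases hk' : k = n
      · rw [hk', hNn]
        exact (hSmeas n).add (hJmeas n hn le_rfl)
      rw [hNR k hk hk']
      exact hRmeas k (by omega) (by omega))
    (by
      intro k h1 h2
      by_cases hk : k = t
      · rw [hk, hNt]
        exact hint₃ t ht
      by_cases hk' : k = n
      · rw [hk', hNn]
        exact hint₁
      rw [hNR k hk hk']
      exact hRint k (by omega) (by omega))
    (by
      intro k h1 h2
      refine EventuallyLE.trans (EventuallyEq.le ?_) (ae_of_all _ (hNge k h2))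
      by_cases hk : k + 1 = n
      · obtain rfl : k = n - 1 := by omega
        rw [hk, hNn]
        exact hVlast.symm
      · rw [hNR (k + 1) (by omega) hk]
        exact hRcond (k + 1) (by omega) (by omega))
    (by
      intro k h1 h2
      by_cases hk : k = n
      · subst hk
        simp only [hNn, add_sub_cancel_left]
        exact ⟨hint₂, hlamlast.le⟩
      · simp only [hNR k (by omega) hk]
        exact hRl k (by omega) (by omega))
  intro W' hW'
  exact (hW' (M t) ⟨M, hM, rfl⟩).trans_eq (hMt.trans (by rw [hNt]))
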